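/- arXiv:2108.04302 — 2 statements merged into one kernel-verified Lean document; each statement's English description precedes it below -/
import Mathlib

section
/- For every n ≥ 1, Σ_{d=0}^{n−1} 2^d · e_{n,d} = Σ_{j=0}^{⌊n/2⌋} (−1)^j · 2^{n−j−1} · binom(n−j, j) · C_{n−j}, where C_m denotes the m-th Catalan number. -/
/-- The number of descents of a permutation `σ` of `Fin n`:
positions `i` (0-based) with `σ (i+1) < σ i`. -/
noncomputable def descents {n : ℕ} (σ : Equiv.Perm (Fin n)) : ℕ :=
  Nat.card {q : Fin n × Fin n // q.1.val + 1 = q.2.val ∧ σ q.2 < σ q.1}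

/-- `σ` contains the pattern 123. -/
def Contains123 {n : ℕ} (σ : Equiv.Perm (Fin n)) : Prop :=
  ∃ i j k : Fin n, i < j ∧ j < k ∧ σ i < σ j ∧ σ j < σ k

/-- `e123 n d` is the number of 123-avoiding permutations of `[n]` with exactly `d` descents. -/
noncomputable def e123 (n d : ℕ) : ℕ :=
  Nat.card {σ : Equiv.Perm (Fin n) // ¬ Contains123 σ ∧ descents σ = d}

open Finset

/-- The permutation of `Fin (n + 1)` with first value `a` whose remaining values are in the same
relative order as those of `τ`. -/
def consPerm {n : ℕ} (a : Fin (n + 1)) (τ : Equiv.Perm (Fin n)) : Equiv.Perm (Fin (n + 1)) :=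
  (finSuccEquiv n).trans (τ.optionCongr.trans (finSuccEquiv' a).symm)

@[simp]
theorem consPerm_zero {n : ℕ} (a : Fin (n + 1)) (τ : Equiv.Perm (Fin n)) :
    consPerm a τ 0 = a := by
  simp [consPerm]

@[simp]
theorem consPerm_succ {n : ℕ} (a : Fin (n + 1)) (τ : Equiv.Perm (Fin n)) (i : Fin n) :
    consPerm a τ i.succ = a.succAbove (τ i) := by
  simp [consPerm]

theorem consPerm_bijective (n : ℕ) :
    Function.Bijective fun x : Equiv.Perm (Fin n) × Fin (n + 1) => consPerm x.2 x.1 := by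
  rw [Fintype.bijective_iff_injective_and_card]
  constructor
  · rintro ⟨τ, a⟩ ⟨τ', a'⟩ h
    have h0 : a = a' := by simpa using DFunLike.congr_fun h 0
    subst h0
    have h1 : τ = τ' := by
      ext i : 1
      simpa using DFunLike.congr_fun h i.succ
    rw [h1]
  · simp [Fintype.card_perm, Nat.factorial_succ, mul_comm]

theorem sum_perm_succ {n : ℕ} {M : Type*} [AddCommMonoid M]
    (F : Equiv.Perm (Fin (n + 1)) → M) :
    ∑ σ, F σ = ∑ τ : Equiv.Perm (Fin n), ∑ a, F (consPerm a τ) := by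
  rw [← (consPerm_bijective n).sum_comp F, Fintype.sum_prod_type]

theorem lt_succAbove_iff {n : ℕ} (a : Fin (n + 1)) (b : Fin n) :
    a < a.succAbove b ↔ a.val ≤ b.val := by
  rw [Fin.lt_succAbove_iff_le_castSucc, Fin.le_def, Fin.val_castSucc]

theorem succAbove_lt_iff {n : ℕ} (a : Fin (n + 1)) (b : Fin n) :
    a.succAbove b < a ↔ b.val < a.val := by
  rw [Fin.succAbove_lt_iff_castSucc_lt, Fin.lt_def, Fin.val_castSucc]

/-- The least `m` such that every first entry of an occurrence of the pattern 12 in `σ` is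
less than `m`. -/
def ascentBound {n : ℕ} (σ : Equiv.Perm (Fin n)) : ℕ :=
  univ.sup fun i => if ∃ j, i < j ∧ σ i < σ j then (σ i).val + 1 else 0

theorem ascentBound_le_iff {n : ℕ} (σ : Equiv.Perm (Fin n)) (m : ℕ) :
    ascentBound σ ≤ m ↔ ∀ i j, i < j → σ i < σ j → (σ i).val < m := by
  simp only [ascentBound, Finset.sup_le_iff, mem_univ, true_implies]
  refine forall_congr' fun i => ?_
  split_ifs with h
  · obtain ⟨j, hj⟩ := h
    exact ⟨fun h' _ _ _ => h', fun h' => h' j hj.1 hj.2⟩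
  · exact ⟨fun _ j h1 h2 => (h ⟨j, h1, h2⟩).elim, fun _ => Nat.zero_le _⟩

theorem ascentBound_le {n : ℕ} (σ : Equiv.Perm (Fin n)) : ascentBound σ ≤ n :=
  (ascentBound_le_iff σ n).2 fun i _ _ _ => (σ i).isLt

theorem not_contains123_consPerm_iff {n : ℕ} (a : Fin (n + 1)) (τ : Equiv.Perm (Fin n)) :
    ¬ Contains123 (consPerm a τ) ↔ ¬ Contains123 τ ∧ ascentBound τ ≤ a.val := by
  rw [ascentBound_le_iff]
  constructor
  · intro h
    refine ⟨?_, fun i j hij hτ => ?_⟩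
    · rintro ⟨i, j, k, hij, hjk, h1, h2⟩
      exact h ⟨i.succ, j.succ, k.succ, by simpa, by simpa, by simpa, by simpa⟩
    · by_contra hlt
      exact h ⟨0, i.succ, j.succ, Fin.succ_pos i, by simpa,
        by simpa [lt_succAbove_iff] using hlt, by simpa⟩
  · rintro ⟨h1, h2⟩ ⟨i, j, k, hij, hjk, hσ1, hσ2⟩
    obtain ⟨j, rfl⟩ := Fin.exists_succ_eq.2 (Fin.ne_zero_of_lt hij)
    obtain ⟨k, rfl⟩ := Fin.exists_succ_eq.2 (Fin.ne_zero_of_lt hjk)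
    simp only [consPerm_succ, Fin.succ_lt_succ_iff, Fin.succAbove_lt_succAbove_iff] at hjk hσ2
    induction i using Fin.cases with
    | zero =>
      rw [consPerm_zero, consPerm_succ, lt_succAbove_iff] at hσ1
      exact absurd (h2 j k hjk hσ2) (not_lt.2 hσ1)
    | succ i =>
      simp only [consPerm_succ, Fin.succ_lt_succ_iff, Fin.succAbove_lt_succAbove_iff] at hij hσ1
      exact h1 ⟨i, j, k, hij, hjk, hσ1, hσ2⟩

theorem ascentBound_consPerm_last {n : ℕ} (τ : Equiv.Perm (Fin n)) :
    ascentBound (consPerm (Fin.last n) τ) = ascentBound τ := by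
  refine eq_of_forall_ge_iff fun m => ?_
  simp only [ascentBound_le_iff]
  constructor
  · intro h i j hij hτ
    simpa using h i.succ j.succ (by simpa) (by simpa)
  · intro h i j hij hσ
    obtain ⟨j, rfl⟩ := Fin.exists_succ_eq.2 (Fin.ne_zero_of_lt hij)
    induction i using Fin.cases with
    | zero => exact absurd hσ (by simpa using Fin.le_last _)
    | succ i => simpa using h i j (by simpa using hij) (by simpa using hσ)

theorem ascentBound_consPerm_castSucc {n : ℕ} (b : Fin n) (τ : Equiv.Perm (Fin n))
    (h : ascentBound τ ≤ b.val) :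
    ascentBound (consPerm b.castSucc τ) = b.val + 1 := by
  rw [ascentBound_le_iff] at h
  refine eq_of_forall_ge_iff fun m => ?_
  rw [ascentBound_le_iff]
  constructor
  · intro h'
    have := h' 0 (τ.symm b).succ (Fin.succ_pos _) (by simp)
    simpa using this
  · intro hm i j hij hσ
    obtain ⟨j, rfl⟩ := Fin.exists_succ_eq.2 (Fin.ne_zero_of_lt hij)
    induction i using Fin.cases with
    | zero => simpa using hm
    | succ i =>
      have hi := h i j (by simpa using hij) (by simpa using hσ)
      rw [consPerm_succ, Fin.succAbove_of_castSucc_lt _ _ (Fin.castSucc_lt_castSucc_iff.2 (Fin.lt_def.2 hi))]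
      simp only [Fin.val_castSucc]
      omega

/-- In a 123-avoiding permutation that does not start with its maximum, every 12 pattern starts
at or below the first value. -/
theorem ascentBound_eq_of_ne_last {n : ℕ} (σ : Equiv.Perm (Fin (n + 1)))
    (hσ : ¬ Contains123 σ) (h0 : σ 0 ≠ Fin.last n) : ascentBound σ = (σ 0).val + 1 := by
  refine eq_of_forall_ge_iff fun m => ?_
  rw [ascentBound_le_iff]
  constructor
  · intro h
    have hpos : 0 < σ.symm (Fin.last n) := by
      rw [Fin.pos_iff_ne_zero]
      intro h'
      exact h0 (by rw [← h', Equiv.apply_symm_apply])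
    exact h 0 _ hpos (by simpa using Fin.lt_last_iff_ne_last.2 h0)
  · intro hm i j hij hlt
    rcases eq_or_ne i 0 with rfl | hi
    · exact hm
    · have : ¬ σ 0 < σ i := fun h => hσ ⟨0, i, j, Fin.pos_iff_ne_zero.2 hi, hij, h, hlt⟩
      have := Fin.le_def.1 (not_lt.1 this)
      omega

theorem descents_eq_sum {n : ℕ} (σ : Equiv.Perm (Fin (n + 1))) :
    descents σ = ∑ i : Fin n, if σ i.succ < σ i.castSucc then 1 else 0 := by
  rw [← card_filter, ← Fintype.card_subtype, ← Nat.card_eq_fintype_card]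
  refine Nat.card_congr
    { toFun := fun q => ⟨⟨q.1.1, by have := q.1.2.isLt; have := q.2.1; omega⟩, ?_⟩
      invFun := fun i => ⟨(i.1.castSucc, i.1.succ), by simp, i.2⟩
      left_inv := ?_
      right_inv := ?_ }
  · obtain ⟨⟨q, q'⟩, h, hq⟩ := q
    convert hq using 2
    · rw [Fin.ext_iff]
      exact h
    · rfl
  · rintro ⟨⟨q, q'⟩, h, hq⟩
    exact Subtype.ext (Prod.ext rfl (Fin.ext h))
  · rintro ⟨i, hi⟩
    rfl

theorem descents_lt {n : ℕ} (σ : Equiv.Perm (Fin (n + 1))) : descents σ < n + 1 := by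
  rw [descents_eq_sum, ← card_filter, Nat.lt_succ_iff]
  exact (card_filter_le _ _).trans_eq (by simp)

theorem descents_consPerm {n : ℕ} (a : Fin (n + 2)) (τ : Equiv.Perm (Fin (n + 1))) :
    descents (consPerm a τ) = descents τ + if (τ 0).val < a.val then 1 else 0 := by
  rw [descents_eq_sum, Fin.sum_univ_succ, descents_eq_sum, add_comm]
  congr 1
  · simp
  · rw [Fin.castSucc_zero, consPerm_succ, consPerm_zero]
    simp only [succAbove_lt_iff]

/-- The generating-tree operator: `g true p` and `g false p` are the values at a permutation that
does or does not start with its maximum, and that has `p + 1` extensions. -/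
def treeStep (g : Bool → ℕ → ℕ) (b : Bool) (p : ℕ) : ℕ :=
  2 * g true (p + 1) + (if b then 1 else 2) * ∑ j ∈ range p, g false (j + 1)

open Classical in
/-- The sum over 123-avoiding permutations of `2 ^ descents` times `g` at the node of the
generating tree given by the permutation. -/
noncomputable def weightSum (n : ℕ) (g : Bool → ℕ → ℕ) : ℕ :=
  ∑ σ : Equiv.Perm (Fin (n + 1)), if Contains123 σ then 0 else
    2 ^ descents σ * g (decide (σ 0 = Fin.last n)) (n + 1 - ascentBound σ)

theorem sum_extensions {n : ℕ} (g : Bool → ℕ → ℕ) (τ : Equiv.Perm (Fin (n + 1)))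
    (hτ : ¬ Contains123 τ) :
    (∑ a : Fin (n + 2), if a.val < ascentBound τ then 0 else
      2 ^ descents (consPerm a τ) *
        g (decide (a = Fin.last (n + 1))) (n + 2 - ascentBound (consPerm a τ))) =
    2 ^ descents τ * treeStep g (decide (τ 0 = Fin.last n)) (n + 1 - ascentBound τ) := by
  have hle := ascentBound_le τ
  have hsum : ∀ c : ℕ, (∑ b : Fin (n + 1), if b.val < ascentBound τ then 0 else
      c * g false (n + 1 - b.val)) =
      c * ∑ j ∈ range (n + 1 - ascentBound τ), g false (j + 1) := by
    intro c
    rw [Fin.sum_univ_eq_sum_range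
      (fun b => if b < ascentBound τ then 0 else c * g false (n + 1 - b)) (n + 1),
      ← sum_range_reflect, mul_sum]
    have hs : range (n + 1 - ascentBound τ) ⊆ range (n + 1) :=
      range_subset_range.2 (Nat.sub_le _ _)
    rw [← sum_subset hs]
    · refine sum_congr rfl fun j hj => ?_
      rw [mem_range] at hj
      rw [if_neg (by omega)]
      congr 2
      omega
    · intro j hj hj'
      rw [mem_range] at hj hj'
      rw [if_pos (by omega)]
  rw [Fin.sum_univ_castSucc, add_comm, treeStep, mul_add]
  congr 1
  · rw [if_neg (by simpa using hle), ascentBound_consPerm_last, descents_consPerm,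
      if_pos (by simpa using (τ 0).isLt), pow_succ, decide_eq_true rfl, mul_assoc,
      show n + 2 - ascentBound τ = n + 1 - ascentBound τ + 1 by omega]
  · rw [← mul_assoc, ← hsum]
    refine sum_congr rfl fun b _ => ?_
    rw [Fin.val_castSucc]
    split_ifs with hb htop
    · rfl
    all_goals
      rw [ascentBound_consPerm_castSucc _ _ (not_lt.1 hb), descents_consPerm,
        decide_eq_false (Fin.castSucc_lt_last b).ne,
        show n + 2 - (b.val + 1) = n + 1 - b.val by omega]
    · have htop : τ 0 = Fin.last n := by simpa using htop
      rw [if_neg (by rw [htop, Fin.val_castSucc, Fin.val_last]; omega), add_zero, mul_one]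
    · have htop : τ 0 ≠ Fin.last n := by simpa using htop
      have := ascentBound_eq_of_ne_last τ hτ htop
      rw [if_pos (by rw [Fin.val_castSucc]; omega), pow_succ]

theorem weightSum_succ (n : ℕ) (g : Bool → ℕ → ℕ) :
    weightSum (n + 1) g = weightSum n (treeStep g) := by
  classical
  rw [weightSum, sum_perm_succ, weightSum]
  refine sum_congr rfl fun τ _ => ?_
  split_ifs with hτ
  · refine sum_eq_zero fun a _ => if_pos ?_
    by_contra h
    exact ((not_contains123_consPerm_iff a τ).1 h).1 hτ
  · rw [← sum_extensions g τ hτ]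
    refine sum_congr rfl fun a _ => ?_
    rw [consPerm_zero]
    refine if_congr ?_ rfl rfl
    rw [← not_iff_not, not_contains123_consPerm_iff, not_lt]
    simp [hτ]

theorem weightSum_zero (g : Bool → ℕ → ℕ) : weightSum 0 g = g true 1 := by
  have h1 : ∀ σ : Equiv.Perm (Fin 1), ¬ Contains123 σ := by
    rintro σ ⟨i, j, -, hij, -⟩
    exact absurd hij (by rw [Subsingleton.elim i j]; exact lt_irrefl _)
  have h2 : ∀ σ : Equiv.Perm (Fin 1), ascentBound σ = 0 := fun σ =>
    Nat.le_zero.1 <| (ascentBound_le_iff σ 0).2 fun i j hij =>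
      absurd hij (by rw [Subsingleton.elim i j]; exact lt_irrefl _)
  have h3 : ∀ σ : Equiv.Perm (Fin 1), descents σ = 0 := fun σ => by simp [descents_eq_sum]
  simp [weightSum, h1, h2, h3]

theorem weightSum_eq_iterate (n : ℕ) (g : Bool → ℕ → ℕ) :
    weightSum n g = treeStep^[n] g true 1 := by
  induction n generalizing g with
  | zero => exact weightSum_zero g
  | succ n ih => rw [weightSum_succ, ih, Function.iterate_succ_apply]

theorem sum_two_pow_mul_e123 (n : ℕ) :
    ∑ d ∈ range (n + 1), 2 ^ d * e123 (n + 1) d = weightSum n 1 := by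
  classical
  have hcard : ∀ d, e123 (n + 1) d =
      #{σ : Equiv.Perm (Fin (n + 1)) | ¬ Contains123 σ ∧ descents σ = d} := fun d => by
    rw [e123, Nat.card_eq_fintype_card, Fintype.card_subtype]
  simp only [hcard, card_filter, mul_sum]
  rw [sum_comm, weightSum]
  refine sum_congr rfl fun σ _ => ?_
  split_ifs with h
  · simp [h]
  · simp [h, descents_lt σ]

open PowerSeries

/-- The Catalan series evaluated at `2 X (1 - X)`. -/
noncomputable def catalanComp : ℚ⟦X⟧ :=
  (catalanSeries.map (Nat.castRingHom ℚ)).subst (2 * X * (1 - X) : ℚ⟦X⟧)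

theorem hasSubst_two_mul_X_mul_one_sub_X : HasSubst (2 * X * (1 - X) : ℚ⟦X⟧) :=
  HasSubst.of_constantCoeff_zero' (by simp)

theorem catalanComp_eq : catalanComp = 1 + 2 * X * (1 - X) * catalanComp ^ 2 := by
  have hs := hasSubst_two_mul_X_mul_one_sub_X
  have h := congrArg (fun f => (f.map (Nat.castRingHom ℚ)).subst (2 * X * (1 - X) : ℚ⟦X⟧))
    catalanSeries_sq_mul_X_add_one
  simp only [map_add, map_mul, map_pow, map_one, PowerSeries.map_X] at h
  rw [← coe_substAlgHom hs, map_add, map_mul, map_pow, map_one, substAlgHom_X hs,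
    coe_substAlgHom hs] at h
  change catalanComp ^ 2 * _ + 1 = catalanComp at h
  linear_combination -h

theorem coeff_two_mul_X_mul_one_sub_X_pow (n d : ℕ) :
    coeff n ((2 * X * (1 - X) : ℚ⟦X⟧) ^ d) =
      if d ≤ n then 2 ^ d * ((-1) ^ (n - d) * (d.choose (n - d) : ℚ)) else 0 := by
  have h1 : (2 * X * (1 - X) : ℚ⟦X⟧) ^ d =
      X ^ d * (C (2 ^ d) * evalNegHom ((1 + X) ^ d)) := by
    simp only [mul_pow, map_pow, map_add, map_one, evalNegHom_X]
    rw [show (C (2 : ℚ) : ℚ⟦X⟧) = 2 from map_ofNat _ 2]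
    ring
  rw [h1, coeff_X_pow_mul']
  refine if_congr Iff.rfl ?_ rfl
  rw [coeff_C_mul, evalNegHom, coeff_rescale]
  have h2 : ((1 + X : ℚ⟦X⟧) ^ d) = (((1 + Polynomial.X) ^ d : Polynomial ℚ) : ℚ⟦X⟧) := by simp
  rw [h2, Polynomial.coeff_coe, Polynomial.coeff_one_add_X_pow]

theorem coeff_catalanComp (n : ℕ) :
    coeff n catalanComp = ∑ j ∈ range (n / 2 + 1),
      (-1) ^ j * 2 ^ (n - j) * ((n - j).choose j : ℚ) * (catalan (n - j) : ℚ) := by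
  rw [catalanComp, coeff_subst' hasSubst_two_mul_X_mul_one_sub_X,
    finsum_eq_sum_of_support_subset (s := range (n + 1)), ← sum_range_reflect]
  · symm
    refine (sum_subset (range_subset_range.2 (by omega)) ?_).trans (sum_congr rfl ?_)
    · intro j hj hj'
      rw [mem_range] at hj hj'
      rw [Nat.choose_eq_zero_of_lt (by omega)]
      simp
    · intro j hj
      rw [mem_range] at hj
      rw [coeff_two_mul_X_mul_one_sub_X_pow, if_pos (by omega),
        show n + 1 - 1 - j = n - j by omega, show n - (n - j) = j by omega]
      simp
      ring
  · intro d hd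
    rw [Function.mem_support, coeff_two_mul_X_mul_one_sub_X_pow] at hd
    simp only [coe_range, Set.mem_Iio]
    by_contra h
    exact hd (by rw [if_neg (by omega), smul_zero])

/-- The generating function, by the number of steps, of the iterates of `treeStep` at
`true` and `p`. -/
noncomputable def treeSeries (p : ℕ) : ℚ⟦X⟧ :=
  (2 * (1 - X))⁻¹ + (2 * (1 - X * catalanComp))⁻¹ * catalanComp ^ (p + 1)

theorem inv_two_mul_one_sub_X : (2 * (1 - X) : ℚ⟦X⟧)⁻¹ * (2 * (1 - X)) = 1 :=
  PowerSeries.inv_mul_cancel _ (by simp [map_ofNat])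

theorem inv_two_mul_one_sub_X_mul_catalanComp :
    (2 * (1 - X * catalanComp) : ℚ⟦X⟧)⁻¹ * (2 * (1 - X * catalanComp)) = 1 :=
  PowerSeries.inv_mul_cancel _ (by simp [map_ofNat])

theorem treeSeries_zero : treeSeries 0 = catalanComp := by
  have hc := inv_two_mul_one_sub_X
  have hb := inv_two_mul_one_sub_X_mul_catalanComp
  have hS := catalanComp_eq
  rw [treeSeries]
  generalize (2 * (1 - X) : ℚ⟦X⟧)⁻¹ = c at *
  generalize (2 * (1 - X * catalanComp) : ℚ⟦X⟧)⁻¹ = b at *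
  generalize catalanComp = S at *
  linear_combination -2 * c * b * hS - c * hb - b * S * hc +
    S * b * (2 * (1 - X * S)) * hc + S * hb

theorem treeSeries_zero_eq : treeSeries 0 = 1 + 2 * X * treeSeries 1 := by
  have hc := inv_two_mul_one_sub_X
  have hb := inv_two_mul_one_sub_X_mul_catalanComp
  have hS := catalanComp_eq
  rw [treeSeries, treeSeries]
  generalize (2 * (1 - X) : ℚ⟦X⟧)⁻¹ = c at *
  generalize (2 * (1 - X * catalanComp) : ℚ⟦X⟧)⁻¹ = b at *
  generalize catalanComp = S at *
  linear_combination hc + c * hb - b * (S - 2 * X * S ^ 2) * hc + 2 * c * b * hS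

theorem treeSeries_succ (p : ℕ) :
    treeSeries (p + 1) = treeSeries p + X * (2 * (1 - X) * treeSeries (p + 2) - 1) := by
  have hc := inv_two_mul_one_sub_X
  rw [treeSeries, treeSeries, treeSeries]
  linear_combination
    (2 * (1 - X * catalanComp))⁻¹ * catalanComp ^ (p + 1) * catalanComp_eq - X * hc

/-- The generating function, by the number of steps, of the iterates of `treeStep` at
`false` and `p`. -/
noncomputable def treeSeriesFalse (p : ℕ) : ℚ⟦X⟧ :=
  2 * treeSeries p - 1 - 2 * X * treeSeries (p + 1)

theorem treeSeries_eq (p : ℕ) :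
    treeSeries p =
      1 + X * (2 * treeSeries (p + 1) + ∑ j ∈ range p, treeSeriesFalse (j + 1)) := by
  induction p with
  | zero => rw [treeSeries_zero_eq]; simp; ring
  | succ p ih =>
    rw [sum_range_succ, treeSeriesFalse]
    linear_combination ih + treeSeries_succ p

theorem treeSeriesFalse_eq (p : ℕ) :
    treeSeriesFalse p =
      1 + X * (2 * (treeSeries (p + 1) + ∑ j ∈ range p, treeSeriesFalse (j + 1))) := by
  rw [treeSeriesFalse]
  linear_combination 2 * treeSeries_eq p

theorem coeff_treeSeries (r : ℕ) : ∀ p,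
    coeff r (treeSeries p) = (treeStep^[r] 1 true p : ℚ) ∧
      coeff r (treeSeriesFalse p) = (treeStep^[r] 1 false p : ℚ) := by
  have h2 : (2 : ℚ⟦X⟧) = C 2 := (map_ofNat C 2).symm
  induction r with
  | zero =>
    intro p
    rw [treeSeries_eq, treeSeriesFalse_eq]
    simp
  | succ r ih =>
    intro p
    rw [treeSeries_eq, treeSeriesFalse_eq, Function.iterate_succ_apply', h2]
    simp [coeff_succ_X_mul, coeff_one, coeff_C_mul, treeStep, map_sum, (ih _).1, (ih _).2, mul_add]

theorem two_mul_weightSum (n : ℕ) : (2 * weightSum n 1 : ℚ) = coeff (n + 1) catalanComp := by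
  rw [weightSum_eq_iterate, ← (coeff_treeSeries n 1).1, ← treeSeries_zero, treeSeries_zero_eq,
    show (2 : ℚ⟦X⟧) = C 2 from (map_ofNat C 2).symm, mul_assoc]
  simp [coeff_one, coeff_C_mul, coeff_succ_X_mul]

/-- `Σ_{d=0}^{n-1} 2^d · e_{n,d}
      = Σ_{j=0}^{⌊n/2⌋} (-1)^j · 2^(n-j-1) · binom(n-j, j) · C_{n-j}`. -/
theorem sum_e123_eq_catalan_sum (n : ℕ) (hn : 1 ≤ n) :
    (∑ d ∈ Finset.range n, 2 ^ d * e123 n d : ℤ)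
      = ∑ j ∈ Finset.range (n / 2 + 1),
          (-1) ^ j * 2 ^ (n - j - 1) * ((n - j).choose j : ℤ) * (catalan (n - j) : ℤ) := by
  obtain ⟨m, rfl⟩ := Nat.exists_eq_add_of_le' hn
  have hL : (∑ d ∈ Finset.range (m + 1), 2 ^ d * e123 (m + 1) d : ℤ) = weightSum m 1 := by
    exact_mod_cast sum_two_pow_mul_e123 m
  rw [hL]
  have h := (two_mul_weightSum m).trans (coeff_catalanComp (m + 1))
  refine mul_left_cancel₀ (two_ne_zero : (2 : ℤ) ≠ 0) ?_
  have hR : (2 : ℤ) * ∑ j ∈ Finset.range ((m + 1) / 2 + 1),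
      (-1) ^ j * 2 ^ (m + 1 - j - 1) * ((m + 1 - j).choose j : ℤ) * (catalan (m + 1 - j) : ℤ) =
      ∑ j ∈ Finset.range ((m + 1) / 2 + 1),
      (-1) ^ j * 2 ^ (m + 1 - j) * ((m + 1 - j).choose j : ℤ) * (catalan (m + 1 - j) : ℤ) := by
    rw [Finset.mul_sum]
    refine Finset.sum_congr rfl fun j hj => ?_
    rw [Finset.mem_range] at hj
    obtain ⟨k, hk⟩ : ∃ k, m + 1 - j = k + 1 := ⟨m - j, by omega⟩
    rw [hk, Nat.add_sub_cancel, pow_succ]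
    ring
  rw [hR]
  exact_mod_cast h
end

section
/- ℓ_{3,1} = 1, and for every n > 3 and 1 ≤ d ≤ n − 2, ℓ_{n,d} = (d+1)·N_{n−1,d} + (n−d)·N_{n−1,d−1} − N_{n,d}. -/
/-- `σ` contains the pattern 213. -/
def Contains213 {n : ℕ} (σ : Equiv.Perm (Fin n)) : Prop :=
  ∃ i j k : Fin n, i < j ∧ j < k ∧ σ j < σ i ∧ σ i < σ k

/-- The reduction of `σ` (obtained by deleting the largest entry from the
one-line notation of `σ`) avoids the pattern 213; equivalently, `σ` has no
occurrence of 213 using only entries different from the maximum value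
(in an occurrence `σ j < σ i < σ k` only `σ k` can be the maximum). -/
def ReductionAvoids213 {n : ℕ} (σ : Equiv.Perm (Fin n)) : Prop :=
  ¬ ∃ i j k : Fin n, i < j ∧ j < k ∧ σ j < σ i ∧ σ i < σ k ∧ ∃ l, σ k < σ l

/-- `nar n d` is the number of 213-avoiding permutations of `[n]` with exactly `d`
descents (the Narayana number `N_{n,d}`). -/
noncomputable def nar (n d : ℕ) : ℕ :=
  Nat.card {σ : Equiv.Perm (Fin n) // ¬ Contains213 σ ∧ descents σ = d}

/-- `l213 n d` is the number of permutations of `[n]` that contain the pattern 213,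
have exactly `d` descents, and whose reduction (deleting the entry `n`) avoids 213. -/
noncomputable def l213 (n d : ℕ) : ℕ :=
  Nat.card {σ : Equiv.Perm (Fin n) //
    Contains213 σ ∧ descents σ = d ∧ ReductionAvoids213 σ}

open Finset

/-- The sequence of values of a permutation, as a function on `ℕ` extended by zero. -/
def permSeq {n : ℕ} (σ : Equiv.Perm (Fin n)) (i : ℕ) : ℕ :=
  if h : i < n then σ ⟨i, h⟩ else 0

/-- `f` has a descent ending at position `i`. -/
def IsDescentAt (f : ℕ → ℕ) (i : ℕ) : Prop :=
  0 < i ∧ f i < f (i - 1)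

instance (f : ℕ → ℕ) : DecidablePred (IsDescentAt f) :=
  fun _ => inferInstanceAs (Decidable (_ ∧ _))

/-- The number of descents among the first `n` values of `f`. -/
def seqDescents (f : ℕ → ℕ) (n : ℕ) : ℕ :=
  ((range n).filter (IsDescentAt f)).card

theorem seqDescents_succ (f : ℕ → ℕ) (n : ℕ) :
    seqDescents f (n + 1) = seqDescents f n + if IsDescentAt f n then 1 else 0 := by
  simp only [seqDescents, range_add_one, filter_insert]
  split_ifs <;> simp

theorem descents_eq_seqDescents {n : ℕ} (σ : Equiv.Perm (Fin n)) :
    descents σ = seqDescents (permSeq σ) n := by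
  classical
  rw [descents, Nat.card_eq_fintype_card, Fintype.card_subtype, seqDescents]
  refine card_bij (fun q _ => q.2.val) ?_ ?_ ?_
  · rintro ⟨a, b⟩ h
    obtain ⟨hab, h⟩ : a.val + 1 = b.val ∧ σ b < σ a := by simpa using h
    have ha : b.val - 1 = a.val := by omega
    simp only [mem_filter, mem_range, IsDescentAt, permSeq, ha, b.isLt, a.isLt, dite_true]
    exact ⟨trivial, by omega, h⟩
  · rintro ⟨a, b⟩ h ⟨a', b'⟩ h' e
    simp only [mem_filter, mem_univ, true_and] at h h' e
    ext <;> simp only <;> omega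
  · intro b hb
    simp only [mem_filter, mem_range, IsDescentAt, permSeq] at hb
    obtain ⟨hbn, hb0, hlt⟩ := hb
    have hb' : b - 1 < n := by omega
    rw [dif_pos hbn, dif_pos hb'] at hlt
    refine ⟨(⟨b - 1, hb'⟩, ⟨b, hbn⟩), ?_, rfl⟩
    simp only [mem_filter, mem_univ, true_and]
    exact ⟨by omega, hlt⟩

/-- Insert the value `M` at position `p` of the sequence `f`. -/
def insertSeq (M p : ℕ) (f : ℕ → ℕ) (i : ℕ) : ℕ :=
  if i < p then f i else if i = p then M else f (i - 1)

theorem seqDescents_insertSeq_add (f : ℕ → ℕ) (M p m : ℕ) (hf : ∀ i, i < m → f i < M)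
    (hp : p ≤ m) :
    seqDescents (insertSeq M p f) (m + 1) + (if p < m ∧ IsDescentAt f p then 1 else 0)
      = seqDescents f m + if p < m then 1 else 0 := by
  have append : ∀ m, (∀ i, i < m → f i < M) →
      seqDescents (insertSeq M m f) (m + 1) = seqDescents f m := by
    intro m hf
    have hm : ¬ IsDescentAt (insertSeq M m f) m := by
      rintro ⟨h0, h⟩
      have := hf (m - 1) (by omega)
      simp only [insertSeq] at h
      grind
    rw [seqDescents_succ, if_neg hm, add_zero, seqDescents, seqDescents]
    congr 1
    refine filter_congr fun i hi => ?_
    have hi := mem_range.1 hi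
    simp only [IsDescentAt, insertSeq, hi, if_true, show i - 1 < m by omega]
  induction m, hp using Nat.le_induction with
  | base => simp [append p hf]
  | succ m hp ih =>
    have hfm := hf m (by omega)
    specialize ih fun i hi => hf i (by omega)
    have hlast : IsDescentAt (insertSeq M p f) (m + 1) ↔ p = m ∨ IsDescentAt f m := by
      simp only [IsDescentAt, insertSeq]
      grind
    rw [seqDescents_succ _ (m + 1), seqDescents_succ f m]
    simp only [hlast]
    rcases hp.eq_or_lt with rfl | h
    · simp only [lt_irrefl, false_and, if_false] at ih
      simp only [Nat.lt_succ_self, true_and, true_or, if_true]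
      omega
    · simp only [h, true_and, if_true] at ih
      simp only [Nat.lt_succ_of_lt h, true_and, if_true, h.ne, false_or]
      omega

/-- Insert the maximum at position `p` in the one-line notation of `τ`. -/
def insertMax {m : ℕ} (p : Fin (m + 1)) (τ : Equiv.Perm (Fin m)) : Equiv.Perm (Fin (m + 1)) :=
  ((finSuccEquiv' p).trans (Equiv.optionCongr τ)).trans (finSuccEquiv' (Fin.last m)).symm

@[simp]
theorem insertMax_self {m : ℕ} (p : Fin (m + 1)) (τ : Equiv.Perm (Fin m)) :
    insertMax p τ p = Fin.last m := by
  simp [insertMax]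

@[simp]
theorem insertMax_succAbove {m : ℕ} (p : Fin (m + 1)) (τ : Equiv.Perm (Fin m)) (i : Fin m) :
    insertMax p τ (p.succAbove i) = (τ i).castSucc := by
  simp [insertMax]

theorem insertMax_bijective (m : ℕ) :
    Function.Bijective fun x : Fin (m + 1) × Equiv.Perm (Fin m) => insertMax x.1 x.2 := by
  rw [Fintype.bijective_iff_injective_and_card]
  constructor
  · rintro ⟨p, τ⟩ ⟨p', τ'⟩ h
    dsimp only at h
    obtain rfl : p = p' := by
      apply (insertMax p τ).injective
      rw [insertMax_self, h, insertMax_self]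
    congr 1
    ext i
    have := congrArg (fun σ => (σ (p.succAbove i)).val) h
    simpa using this
  · simp [Fintype.card_perm, Nat.factorial_succ]

theorem permSeq_insertMax {m : ℕ} (p : Fin (m + 1)) (τ : Equiv.Perm (Fin m)) (i : ℕ)
    (hi : i < m + 1) :
    permSeq (insertMax p τ) i = insertSeq m p (permSeq τ) i := by
  rw [permSeq, dif_pos hi, insertSeq]
  rcases Fin.eq_self_or_eq_succAbove p ⟨i, hi⟩ with h | ⟨j, h⟩
  · obtain rfl : i = p.val := congrArg Fin.val h
    simp
  · rw [h, insertMax_succAbove]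
    have hv : i = (p.succAbove j).val := congrArg Fin.val h
    rcases lt_or_ge j.castSucc p with hj | hj
    · rw [Fin.succAbove_of_castSucc_lt _ _ hj] at hv
      have hj' : j.val < p.val := hj
      simp only [Fin.val_castSucc] at hv
      simp [hv, hj', permSeq]
    · rw [Fin.succAbove_of_le_castSucc _ _ hj] at hv
      have hj' : p.val ≤ j.val := hj
      simp only [Fin.val_succ] at hv
      rw [if_neg (by omega), if_neg (by omega)]
      simp [hv, permSeq]

theorem descents_insertMax {m : ℕ} (p : Fin (m + 1)) (τ : Equiv.Perm (Fin m)) :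
    descents (insertMax p τ) =
      descents τ + if p.val = m ∨ IsDescentAt (permSeq τ) p then 0 else 1 := by
  have hcongr : seqDescents (permSeq (insertMax p τ)) (m + 1)
      = seqDescents (insertSeq m p (permSeq τ)) (m + 1) := by
    rw [seqDescents, seqDescents]
    congr 1
    refine filter_congr fun i hi => ?_
    have hi := mem_range.1 hi
    rw [IsDescentAt, IsDescentAt, permSeq_insertMax p τ i hi,
      permSeq_insertMax p τ (i - 1) (by omega)]
  have h := seqDescents_insertSeq_add (permSeq τ) m p m
    (fun i hi => by simp [permSeq, hi]) p.is_le
  rw [descents_eq_seqDescents, descents_eq_seqDescents, hcongr]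
  have := p.is_le
  grind

theorem reductionAvoids213_insertMax {m : ℕ} (p : Fin (m + 1)) (τ : Equiv.Perm (Fin m)) :
    ReductionAvoids213 (insertMax p τ) ↔ ¬ Contains213 τ := by
  rw [ReductionAvoids213, not_iff_not]
  constructor
  · rintro ⟨i, j, k, hij, hjk, hji, hik, l, hkl⟩
    have key : ∀ x, insertMax p τ x < insertMax p τ l → ∃ y, x = p.succAbove y := by
      intro x hx
      rcases Fin.eq_self_or_eq_succAbove p x with rfl | h
      · rw [insertMax_self] at hx
        exact absurd hx (Fin.le_last _).not_gt
      · exact h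
    obtain ⟨k, rfl⟩ := key k hkl
    obtain ⟨i, rfl⟩ := key i (hik.trans hkl)
    obtain ⟨j, rfl⟩ := key j (hji.trans (hik.trans hkl))
    simp only [insertMax_succAbove, Fin.castSucc_lt_castSucc_iff] at hji hik
    exact ⟨i, j, k, Fin.succAbove_lt_succAbove_iff.1 hij,
      Fin.succAbove_lt_succAbove_iff.1 hjk, hji, hik⟩
  · rintro ⟨i, j, k, hij, hjk, hji, hik⟩
    refine ⟨p.succAbove i, p.succAbove j, p.succAbove k, Fin.succAbove_lt_succAbove_iff.2 hij,
      Fin.succAbove_lt_succAbove_iff.2 hjk, by simpa using hji, by simpa using hik, p, ?_⟩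
    simp [Fin.castSucc_lt_last]

theorem card_insertion_positions {m : ℕ} (τ : Equiv.Perm (Fin m)) :
    (univ.filter fun p : Fin (m + 1) => p.val = m ∨ IsDescentAt (permSeq τ) p).card
      = descents τ + 1 := by
  have h : (univ.filter fun p : Fin (m + 1) => p.val = m ∨ IsDescentAt (permSeq τ) p).map
      Fin.valEmbedding = insert m ((range m).filter (IsDescentAt (permSeq τ))) := by
    ext i
    simp only [mem_map, mem_filter, mem_univ, true_and, mem_insert, mem_range,
      Fin.valEmbedding_apply]
    constructor
    · rintro ⟨p, hp, rfl⟩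
      have := p.is_le
      grind
    · intro hi
      exact ⟨⟨i, by grind⟩, by grind, rfl⟩
  rw [← card_map Fin.valEmbedding, h, card_insert_of_notMem (by simp), descents_eq_seqDescents,
    seqDescents]

theorem card_filter_descents_insertMax {m : ℕ} (τ : Equiv.Perm (Fin m)) (d : ℕ) :
    ((univ.filter fun p : Fin (m + 1) => descents (insertMax p τ) = d + 1).card : ℤ)
      = (if descents τ = d + 1 then (d + 2 : ℤ) else 0)
        + if descents τ = d then (m - d : ℤ) else 0 := by
  have hcard := card_insertion_positions τ
  have htotal := card_filter_add_card_filter_not (s := (univ : Finset (Fin (m + 1))))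
    (fun p => p.val = m ∨ IsDescentAt (permSeq τ) p)
  rw [hcard, card_univ, Fintype.card_fin] at htotal
  simp only [descents_insertMax]
  by_cases h₁ : descents τ = d + 1
  · have : (univ.filter fun p : Fin (m + 1) => descents τ +
        (if p.val = m ∨ IsDescentAt (permSeq τ) p then 0 else 1) = d + 1)
        = univ.filter fun p : Fin (m + 1) => p.val = m ∨ IsDescentAt (permSeq τ) p :=
      filter_congr fun p _ => by split_ifs with h <;> simp only [h] <;> grind
    rw [this, hcard]
    grind
  · by_cases h₂ : descents τ = d
    · have : (univ.filter fun p : Fin (m + 1) => descents τ +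
          (if p.val = m ∨ IsDescentAt (permSeq τ) p then 0 else 1) = d + 1)
          = univ.filter fun p : Fin (m + 1) => ¬ (p.val = m ∨ IsDescentAt (permSeq τ) p) :=
        filter_congr fun p _ => by split_ifs with h <;> simp only [h] <;> grind
      rw [this]
      grind
    · rw [filter_false_of_mem (fun p _ => by grind)]
      simp [h₁, h₂]

theorem Contains213.of_not_reductionAvoids213 {n : ℕ} {σ : Equiv.Perm (Fin n)}
    (h : ¬ ReductionAvoids213 σ) : Contains213 σ := by
  obtain ⟨i, j, k, hij, hjk, hji, hik, -⟩ := not_not.1 h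
  exact ⟨i, j, k, hij, hjk, hji, hik⟩

open Classical in
theorem l213_add_nar (n d : ℕ) :
    l213 n d + nar n d
      = (univ.filter fun σ : Equiv.Perm (Fin n) => ReductionAvoids213 σ ∧ descents σ = d).card := by
  rw [l213, nar, Nat.card_eq_fintype_card, Nat.card_eq_fintype_card, Fintype.card_subtype,
    Fintype.card_subtype, ← card_filter_add_card_filter_not (p := Contains213)
      (s := univ.filter fun σ : Equiv.Perm (Fin n) => ReductionAvoids213 σ ∧ descents σ = d),
    filter_filter, filter_filter]
  congr 2 <;> refine filter_congr fun σ _ => ?_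
  · tauto
  · have := @Contains213.of_not_reductionAvoids213 n σ
    tauto

open Classical in
theorem card_reductionAvoids213 (m d : ℕ) :
    ((univ.filter fun σ : Equiv.Perm (Fin (m + 1)) =>
        ReductionAvoids213 σ ∧ descents σ = d + 1).card : ℤ)
      = (d + 2) * nar m (d + 1) + (m - d) * nar m d := by
  have hnar : ∀ e, (nar m e : ℤ) = ∑ τ : Equiv.Perm (Fin m) with ¬ Contains213 τ,
      if descents τ = e then (1 : ℤ) else 0 := by
    intro e
    rw [nar, Nat.card_eq_fintype_card, Fintype.card_subtype, ← filter_filter, card_filter]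
    push_cast
    rfl
  rw [hnar, hnar, mul_sum, mul_sum, ← sum_add_distrib, sum_filter, card_filter]
  push_cast
  rw [← (insertMax_bijective m).sum_comp, Fintype.sum_prod_type_right]
  refine sum_congr rfl fun τ _ => ?_
  simp only [reductionAvoids213_insertMax]
  by_cases h : Contains213 τ
  · simp [h]
  · have := card_filter_descents_insertMax τ d
    rw [card_filter] at this
    push_cast at this
    simpa only [h, not_false_eq_true, true_and, if_true, mul_ite, mul_one, mul_zero] using this

instance (n : ℕ) : DecidablePred (Contains213 (n := n)) := fun _ => by
  unfold Contains213
  infer_instance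

instance (n : ℕ) : DecidablePred (ReductionAvoids213 (n := n)) := fun _ => by
  unfold ReductionAvoids213
  infer_instance

theorem l213_three_one : l213 3 1 = 1 := by
  simp only [l213, descents_eq_seqDescents]
  rw [Nat.card_eq_fintype_card, Fintype.card_subtype]
  decide

/-- `ℓ_{3,1} = 1`, and for `n > 3` and `1 ≤ d ≤ n - 2`,
`ℓ_{n,d} = (d+1)·N_{n-1,d} + (n-d)·N_{n-1,d-1} - N_{n,d}`. -/
theorem l213_recurrence :
    l213 3 1 = 1 ∧
    ∀ n d : ℕ, 3 < n → 1 ≤ d → d ≤ n - 2 →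
      (l213 n d : ℤ)
        = (d + 1) * nar (n - 1) d + ((n : ℤ) - d) * nar (n - 1) (d - 1) - nar n d := by
  refine ⟨l213_three_one, fun n d hn hd _ => ?_⟩
  obtain ⟨m, rfl⟩ : ∃ m, n = m + 1 := ⟨n - 1, by omega⟩
  obtain ⟨e, rfl⟩ : ∃ e, d = e + 1 := ⟨d - 1, by omega⟩
  have h := card_reductionAvoids213 m e
  rw [← l213_add_nar] at h
  simp only [Nat.add_sub_cancel]
  push_cast at h ⊢
  linarith
end
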